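/- arXiv:2301.00814 — 2 statements merged into one kernel-verified Lean document; each statement's English description precedes it below -/
import Mathlib

section
/- Let A, B, C, D be polynomials in the time-delay and time-advance operators (finite real linear combinations of monomials). Then the product of first-order commutators Δ₂ = [C, D]∘[A, B] vanishes to first order in the rates: for every smooth φ : ℝ → ℝ and every t ∈ ℝ, the function F(s) = ((Δ₂)φ)(t), defined for all s in some neighborhood of 0, satisfies F(0) = 0 and F′(0) = 0. -/
namespace TDI

variable {ι : Type*}

/-- A signed letter: an index together with a sign
(`true` = time-delay operator, `false` = time-advance operator). -/
abbrev Letter (ι : Type*) := ι × Bool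

/-- A word: a monomial in the time-delay and time-advance operators. -/
abbrev Word (ι : Type*) := List (Letter ι)

/-- A polynomial: a finite real linear combination of monomials. -/
abbrev Poly (ι : Type*) := List (ℝ × Word ι)

/-- The time displacement performed by a single letter at expansion parameter `s`:
a time-delay acts by `t ↦ (1 - s·ℓ i)·t - L i`, a time-advance by its inverse map
`t ↦ (t + L i)/(1 - s·ℓ i)`. -/
noncomputable def letterMap (L l : ι → ℝ) (s : ℝ) (x : Letter ι) (t : ℝ) : ℝ :=
  if x.2 then (1 - s * l x.1) * t - L x.1 else (t + L x.1) / (1 - s * l x.1)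

/-- The total time displacement performed by a word `w = x₁ ⋯ xₙ`, so that the operator
`D_{x₁} ∘ ⋯ ∘ D_{xₙ}` is precomposition with this map. -/
noncomputable def wordMap (L l : ι → ℝ) (s : ℝ) : Word ι → ℝ → ℝ
  | [] => id
  | x :: w => wordMap L l s w ∘ letterMap L l s x

/-- The operator on functions associated to a word (monomial): precomposition with
`wordMap`. -/
noncomputable def wordOp (L l : ι → ℝ) (s : ℝ) (w : Word ι) (φ : ℝ → ℝ) : ℝ → ℝ :=
  φ ∘ wordMap L l s w

/-- The operator on functions associated to a polynomial: the corresponding real linear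
combination of the monomial operators. -/
noncomputable def polyOp (L l : ι → ℝ) (s : ℝ) (P : Poly ι) (φ : ℝ → ℝ) : ℝ → ℝ :=
  fun t => (P.map fun cw => cw.1 * wordOp L l s cw.2 φ t).sum

/-- The commutator `[P, Q] = P∘Q − Q∘P` of two operators on functions. -/
def comm (P Q : (ℝ → ℝ) → ℝ → ℝ) (φ : ℝ → ℝ) (t : ℝ) : ℝ :=
  P (Q φ) t - Q (P φ) t

end TDI

namespace TDI

variable {ι : Type*}

theorem wordMap_zero (L l : ι → ℝ) (w : Word ι) : ∃ a : ℝ, ∀ t, wordMap L l 0 w t = t + a := by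
  induction w with
  | nil => exact ⟨0, fun t => by simp [wordMap]⟩
  | cons x w ih =>
    obtain ⟨a, ha⟩ := ih
    rcases x with ⟨i, b⟩
    cases b
    · exact ⟨L i + a, fun t => by simp [wordMap, letterMap, ha]; ring⟩
    · exact ⟨-L i + a, fun t => by simp [wordMap, letterMap, ha]; ring⟩

theorem polyOp_nil (L l : ι → ℝ) (s : ℝ) (f : ℝ → ℝ) (t : ℝ) : polyOp L l s [] f t = 0 := by
  simp [polyOp]

theorem polyOp_cons (L l : ι → ℝ) (s : ℝ) (c : ℝ × Word ι) (P : Poly ι) (f : ℝ → ℝ) (t : ℝ) :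
    polyOp L l s (c :: P) f t = c.1 * f (wordMap L l s c.2 t) + polyOp L l s P f t := by
  simp [polyOp, wordOp]

theorem polyOp_lin (L l : ι → ℝ) (s : ℝ) (Q : Poly ι) (c : ℝ) (g h : ℝ → ℝ) (t : ℝ) :
    polyOp L l s Q (fun x => c * g x + h x) t
      = c * polyOp L l s Q g t + polyOp L l s Q h t := by
  induction Q with
  | nil => simp [polyOp_nil]
  | cons q Q ih => simp only [polyOp_cons, ih]; ring

theorem word_poly (L l : ι → ℝ) (w : Word ι) (Q : Poly ι) (f : ℝ → ℝ) (t : ℝ) :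
    polyOp L l 0 Q f (wordMap L l 0 w t)
      = polyOp L l 0 Q (fun x => f (wordMap L l 0 w x)) t := by
  induction Q with
  | nil => simp [polyOp_nil]
  | cons q Q ih =>
    obtain ⟨a, ha⟩ := wordMap_zero L l w
    obtain ⟨b, hb⟩ := wordMap_zero L l q.2
    simp only [polyOp_cons, ih]
    simp only [ha, hb, add_right_comm]

theorem poly_comm (L l : ι → ℝ) (P Q : Poly ι) (f : ℝ → ℝ) (t : ℝ) :
    polyOp L l 0 P (polyOp L l 0 Q f) t = polyOp L l 0 Q (polyOp L l 0 P f) t := by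
  induction P with
  | nil =>
    have h : polyOp L l 0 [] f = fun x => 0 * f x + 0 * f x := by
      funext x; simp [polyOp_nil]
    rw [polyOp_nil, h, polyOp_lin L l 0 Q 0 f (fun x => 0 * f x)]
    have := polyOp_lin L l 0 Q 0 f (fun x => 0 * f x) t
    have h2 := polyOp_lin L l 0 Q (-1) (fun x => 0 * f x) (fun x => 0 * f x) t
    simp at h2 ⊢
    exact h2.symm
  | cons c P ih =>
    have h : polyOp L l 0 (c :: P) f
        = fun x => c.1 * f (wordMap L l 0 c.2 x) + polyOp L l 0 P f x := by
      funext x; rw [polyOp_cons]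
    rw [polyOp_cons, ih, h,
      polyOp_lin L l 0 Q c.1 (fun x => f (wordMap L l 0 c.2 x)) (polyOp L l 0 P f), word_poly]

theorem comm_zero (L l : ι → ℝ) (P Q : Poly ι) (f : ℝ → ℝ) (t : ℝ) :
    comm (polyOp L l 0 P) (polyOp L l 0 Q) f t = 0 := by
  rw [comm, poly_comm, sub_self]

theorem diff_letter (L l : ι → ℝ) (x : Letter ι) (t : ℝ) :
    DifferentiableAt ℝ (fun p : ℝ × ℝ => letterMap L l p.1 x p.2) (0, t) := by
  rcases x with ⟨i, b⟩
  cases b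
  · simp only [letterMap, Bool.false_eq_true, if_false]
    have h : DifferentiableAt ℝ (fun p : ℝ × ℝ => (1 - p.1 * l i)⁻¹) (0, t) :=
      DifferentiableAt.inv (by fun_prop) (by simp)
    simp only [div_eq_mul_inv]
    exact DifferentiableAt.mul (by fun_prop) h
  · simp only [letterMap, if_true]
    fun_prop

theorem diff_comp (g m : ℝ → ℝ → ℝ) (t : ℝ)
    (hm : DifferentiableAt ℝ (fun p : ℝ × ℝ => m p.1 p.2) (0, t))
    (hg : ∀ x, DifferentiableAt ℝ (fun p : ℝ × ℝ => g p.1 p.2) (0, x)) :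
    DifferentiableAt ℝ (fun p : ℝ × ℝ => g p.1 (m p.1 p.2)) (0, t) :=
  DifferentiableAt.comp (g := fun p : ℝ × ℝ => g p.1 p.2)
    (f := fun p : ℝ × ℝ => (p.1, m p.1 p.2)) (0, t) (hg _) (differentiableAt_fst.prodMk hm)

theorem diff_word (L l : ι → ℝ) (w : Word ι) : ∀ t : ℝ,
    DifferentiableAt ℝ (fun p : ℝ × ℝ => wordMap L l p.1 w p.2) (0, t) := by
  induction w with
  | nil => intro t; simp only [wordMap, id]; fun_prop
  | cons x w ih =>
    intro t
    exact diff_comp (fun s => wordMap L l s w) (fun s => letterMap L l s x) t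
      (diff_letter L l x t) ih

theorem diff_poly (L l : ι → ℝ) (P : Poly ι) (g : ℝ → ℝ → ℝ)
    (hg : ∀ x, DifferentiableAt ℝ (fun p : ℝ × ℝ => g p.1 p.2) (0, x)) (t : ℝ) :
    DifferentiableAt ℝ (fun p : ℝ × ℝ => polyOp L l p.1 P (g p.1) p.2) (0, t) := by
  induction P with
  | nil => simp only [polyOp_nil]; fun_prop
  | cons c P ih =>
    simp only [polyOp_cons]
    exact ((diff_comp g (fun s => wordMap L l s c.2) t (diff_word L l c.2 t) hg).const_mul
      c.1).add ih

theorem deriv_poly (L l : ι → ℝ) (P : Poly ι) (g : ℝ → ℝ → ℝ) (g' : ℝ → ℝ)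
    (hg : ∀ x, HasFDerivAt (fun p : ℝ × ℝ => g p.1 p.2)
      (g' x • ContinuousLinearMap.fst ℝ ℝ ℝ) (0, x)) (t : ℝ) :
    HasFDerivAt (fun p : ℝ × ℝ => polyOp L l p.1 P (g p.1) p.2)
      (polyOp L l 0 P g' t • ContinuousLinearMap.fst ℝ ℝ ℝ) (0, t) := by
  induction P with
  | nil => simp only [polyOp_nil, zero_smul]; exact hasFDerivAt_const _ _
  | cons c P ih =>
    simp only [polyOp_cons]
    have h1 : HasFDerivAt (fun p : ℝ × ℝ => g p.1 (wordMap L l p.1 c.2 p.2)) _ (0, t) :=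
      HasFDerivAt.comp (g := fun p : ℝ × ℝ => g p.1 p.2)
        (f := fun p : ℝ × ℝ => (p.1, wordMap L l p.1 c.2 p.2)) (0, t)
        (hg (wordMap L l 0 c.2 t)) (hasFDerivAt_fst.prodMk (diff_word L l c.2 t).hasFDerivAt)
    refine ((h1.const_mul c.1).add ih).congr_fderiv ?_
    ext <;> simp

theorem deriv_of_zero (g : ℝ → ℝ → ℝ) (h0 : ∀ x, g 0 x = 0) (x : ℝ)
    (hg : DifferentiableAt ℝ (fun p : ℝ × ℝ => g p.1 p.2) (0, x)) :
    HasFDerivAt (fun p : ℝ × ℝ => g p.1 p.2)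
      ((fderiv ℝ (fun p : ℝ × ℝ => g p.1 p.2) (0, x) (1, 0)) •
        ContinuousLinearMap.fst ℝ ℝ ℝ) (0, x) := by
  refine hg.hasFDerivAt.congr_fderiv ?_
  have h2 : HasDerivAt (fun y : ℝ => g 0 y)
      (fderiv ℝ (fun p : ℝ × ℝ => g p.1 p.2) (0, x) (0, 1)) x :=
    HasFDerivAt.comp_hasDerivAt (f := fun y : ℝ => ((0 : ℝ), y))
      (l := fun p : ℝ × ℝ => g p.1 p.2) x hg.hasFDerivAt
      ((hasDerivAt_const x (0 : ℝ)).prodMk (hasDerivAt_id x))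
  simp only [h0] at h2
  have h3 := h2.unique (hasDerivAt_const x (0 : ℝ))
  ext <;> simp [h3]

end TDI

/-- **Proposition 2.** For polynomials `A, B, C, D` in the time-delay and time-advance
operators, the product of first-order commutators `Δ₂ = [C, D]∘[A, B]` vanishes to first
order in the rates: for every smooth `φ` and every `t`, the function `F(s) = ((Δ₂)φ)(t)`
satisfies `F(0) = 0` and `F′(0) = 0`. -/
theorem proposition2 (ι : Type*) [Fintype ι] (L l : ι → ℝ)
    (A B C D : TDI.Poly ι) (φ : ℝ → ℝ) (hφ : ContDiff ℝ (⊤ : ℕ∞) φ) (t : ℝ) :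
    TDI.comm (TDI.polyOp L l 0 C) (TDI.polyOp L l 0 D)
        (TDI.comm (TDI.polyOp L l 0 A) (TDI.polyOp L l 0 B) φ) t = 0 ∧
      HasDerivAt
        (fun s : ℝ =>
          TDI.comm (TDI.polyOp L l s C) (TDI.polyOp L l s D)
            (TDI.comm (TDI.polyOp L l s A) (TDI.polyOp L l s B) φ) t)
        0 0 := by
  refine ⟨TDI.comm_zero L l C D _ t, ?_⟩
  set g : ℝ → ℝ → ℝ := fun s => TDI.comm (TDI.polyOp L l s A) (TDI.polyOp L l s B) φ with hgdef
  have hφd : Differentiable ℝ φ := hφ.differentiable (by simp)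
  have hφ2 : ∀ x, DifferentiableAt ℝ (fun p : ℝ × ℝ => (fun _ : ℝ => φ) p.1 p.2) (0, x) := by
    intro x
    exact (hφd x).comp (f := fun p : ℝ × ℝ => p.2) (0, x) differentiableAt_snd
  have hg : ∀ x, DifferentiableAt ℝ (fun p : ℝ × ℝ => g p.1 p.2) (0, x) := fun x =>
    (TDI.diff_poly L l A (fun s => TDI.polyOp L l s B φ)
      (TDI.diff_poly L l B (fun _ => φ) hφ2) x).sub
    (TDI.diff_poly L l B (fun s => TDI.polyOp L l s A φ)
      (TDI.diff_poly L l A (fun _ => φ) hφ2) x)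
  have hg' := fun x => TDI.deriv_of_zero g (fun x => TDI.comm_zero L l A B φ x) x (hg x)
  have h := (TDI.deriv_poly L l C (fun s => TDI.polyOp L l s D (g s)) _
      (TDI.deriv_poly L l D g _ hg') t).sub
    (TDI.deriv_poly L l D (fun s => TDI.polyOp L l s C (g s)) _
      (TDI.deriv_poly L l C g _ hg') t)
  have h4 := HasFDerivAt.comp_hasDerivAt (f := fun s : ℝ => (s, t)) (0 : ℝ) h
      ((hasDerivAt_id (0 : ℝ)).prodMk (hasDerivAt_const (0 : ℝ) t))
  refine h4.congr_deriv ?_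
  have h5 := TDI.poly_comm L l C D
    (fun x => fderiv ℝ (fun p : ℝ × ℝ => g p.1 p.2) (0, x) (1, 0)) t
  simpa [sub_eq_zero] using h5
end

section
/- Let K be a finite index set and for each k ∈ K let Δ_k be an operator of the form [C_k, [A_k, B_k]] or of the form [C_k, D_k]∘[A_k, B_k], where A_k, B_k, C_k, D_k are polynomials in the time-delay and time-advance operators, and let P_k, Q_k be further such polynomials. Then the linear combination Δ = Σ_{k ∈ K} P_k ∘ Δ_k ∘ Q_k vanishes to first order in the rates: for every smooth φ : ℝ → ℝ and every t ∈ ℝ, the function F(s) = ((Δ)φ)(t), defined for all s in some neighborhood of 0, satisfies F(0) = 0 and F′(0) = 0. -/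
namespace TDI

variable {ι : Type*}

noncomputable def lb (L : ι → ℝ) (x : Letter ι) : ℝ := if x.2 then - L x.1 else L x.1
noncomputable def la (l : ι → ℝ) (x : Letter ι) : ℝ := if x.2 then - l x.1 else l x.1
noncomputable def lc (L l : ι → ℝ) (x : Letter ι) : ℝ := if x.2 then 0 else L x.1 * l x.1

noncomputable def wb (L : ι → ℝ) : Word ι → ℝ
  | [] => 0
  | x :: w => lb L x + wb L w
noncomputable def wa (l : ι → ℝ) : Word ι → ℝ
  | [] => 0
  | x :: w => la l x + wa l w
noncomputable def wc (L l : ι → ℝ) : Word ι → ℝ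
  | [] => 0
  | x :: w => lc L l x + wc L l w + wa l w * lb L x

lemma wb_append (L : ι → ℝ) (u v : Word ι) : wb L (u ++ v) = wb L u + wb L v := by
  induction u with
  | nil => simp [wb]
  | cons x u ih => simp [wb, ih, add_assoc]
lemma wa_append (l : ι → ℝ) (u v : Word ι) : wa l (u ++ v) = wa l u + wa l v := by
  induction u with
  | nil => simp [wa]
  | cons x u ih => simp [wa, ih, add_assoc]
lemma wc_append (L l : ι → ℝ) (u v : Word ι) :
    wc L l (u ++ v) = wc L l u + wc L l v + wa l v * wb L u := by
  induction u with
  | nil => simp [wc, wb]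
  | cons x u ih => simp only [List.cons_append, wc, wb, ih, wa_append]; ring

lemma wordMap_append (L l : ι → ℝ) (s : ℝ) (u v : Word ι) :
    wordMap L l s (u ++ v) = wordMap L l s v ∘ wordMap L l s u := by
  induction u with
  | nil => simp [wordMap]
  | cons x u ih => simp only [List.cons_append, wordMap, ih, Function.comp_assoc]

lemma letter_affine (L l : ι → ℝ) (x : Letter ι) :
    ∃ a c : ℝ → ℝ, (∀ s t, letterMap L l s x t = a s * t + c s) ∧ a 0 = 1 ∧ c 0 = lb L x ∧
      HasDerivAt a (la l x) 0 ∧ HasDerivAt c (lc L l x) 0 := by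
  obtain ⟨i, e⟩ := x
  have h1 : HasDerivAt (fun s : ℝ => 1 - s * l i) (- l i) 0 := by
    simpa using ((hasDerivAt_id (0:ℝ)).mul_const (l i)).const_sub 1
  cases e
  · have h2 : HasDerivAt (fun s : ℝ => (1 - s * l i)⁻¹) (l i) 0 := by
      simpa using h1.fun_inv (by simp)
    refine ⟨fun s => (1 - s * l i)⁻¹, fun s => L i * (1 - s * l i)⁻¹, ?_, ?_, ?_, ?_, ?_⟩
    · intro s t; simp [letterMap, div_eq_mul_inv]; ring
    · simp
    · simp [lb]
    · simpa [la] using h2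
    · simpa [lc] using h2.const_mul (L i)
  · refine ⟨fun s => (1 - s * l i), fun s => - L i, ?_, ?_, ?_, ?_, ?_⟩
    · intro s t; simp [letterMap]; ring
    · simp
    · simp [lb]
    · simpa [la] using h1
    · simpa [lc] using hasDerivAt_const (0:ℝ) (- L i)

lemma word_affine (L l : ι → ℝ) (w : Word ι) :
    ∃ a c : ℝ → ℝ, (∀ s t, wordMap L l s w t = a s * t + c s) ∧ a 0 = 1 ∧ c 0 = wb L w ∧
      HasDerivAt a (wa l w) 0 ∧ HasDerivAt c (wc L l w) 0 := by
  induction w with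
  | nil =>
    exact ⟨fun _ => 1, fun _ => 0, by simp [wordMap], rfl, rfl, hasDerivAt_const _ _,
      hasDerivAt_const _ _⟩
  | cons x w ih =>
    obtain ⟨a, c, h, a0, c0, ha, hc⟩ := ih
    obtain ⟨a', c', h', a0', c0', ha', hc'⟩ := letter_affine L l x
    refine ⟨fun s => a s * a' s, fun s => a s * c' s + c s, ?_, ?_, ?_, ?_, ?_⟩
    · intro s t; simp only [wordMap, Function.comp, h, h']; ring
    · simp [a0, a0']
    · simp [a0, c0, c0', wb]
    · refine (ha.fun_mul ha').congr_deriv ?_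
      simp only [a0, a0', wa]; ring
    · refine ((ha.fun_mul hc').fun_add hc).congr_deriv ?_
      simp only [a0, c0', wc]; ring

/-- Free associative algebra of polynomials. -/
abbrev FA (ι : Type*) := MonoidAlgebra ℝ (FreeMonoid (Letter ι))

noncomputable def opHom (L l : ι → ℝ) (s : ℝ) :
    FreeMonoid (Letter ι) →* Module.End ℝ (ℝ → ℝ) where
  toFun w := LinearMap.funLeft ℝ ℝ (wordMap L l s w.toList)
  map_one' := by ext; rfl
  map_mul' u v := by
    ext φ t
    simp [LinearMap.funLeft_apply, FreeMonoid.toList_mul, wordMap_append]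

noncomputable def op (L l : ι → ℝ) (s : ℝ) : FA ι →ₐ[ℝ] Module.End ℝ (ℝ → ℝ) :=
  MonoidAlgebra.lift ℝ _ _ (opHom L l s)

lemma op_single (L l : ι → ℝ) (s : ℝ) (w : FreeMonoid (Letter ι)) (c : ℝ) (φ : ℝ → ℝ) (t : ℝ) :
    op L l s (MonoidAlgebra.single w c) φ t = c * φ (wordMap L l s w.toList t) := by
  simp [op, opHom, LinearMap.funLeft_apply]

noncomputable def toFA : Poly ι → FA ι
  | [] => 0
  | cw :: P => MonoidAlgebra.single (FreeMonoid.ofList cw.2) cw.1 + toFA P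

lemma polyOp_eq (L l : ι → ℝ) (s : ℝ) (P : Poly ι) : polyOp L l s P = ⇑(op L l s (toFA P)) := by
  funext φ t
  induction P with
  | nil => simp [polyOp, toFA]
  | cons cw P ih =>
    simp only [polyOp, toFA, List.map_cons, List.sum_cons, map_add, LinearMap.add_apply,
      Pi.add_apply, op_single] at ih ⊢
    rw [ih]; rfl

lemma comm_eq (X Y : Module.End ℝ (ℝ → ℝ)) : comm ⇑X ⇑Y = ⇑(X * Y - Y * X) := by
  funext φ t; simp [comm]

/-- Linear functional extending a function on words. -/
noncomputable def fn (f : FreeMonoid (Letter ι) → ℝ) : FA ι →+ ℝ :=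
  MonoidAlgebra.liftNC (AddMonoidHom.id ℝ) f

lemma fn_single (f : FreeMonoid (Letter ι) → ℝ) (w) (c : ℝ) :
    fn f (MonoidAlgebra.single w c) = c * f w := by
  simp [fn]

lemma fn_dbl (f : FreeMonoid (Letter ι) → ℝ)
    (hf : ∀ p a b c q, f (p * c * a * b * q) - f (p * c * b * a * q)
      - f (p * a * b * c * q) + f (p * b * a * c * q) = 0) (p a b c q : FA ι) :
    fn f (p * (c * (a * b - b * a) - (a * b - b * a) * c) * q) = 0 := by
  have key : ∀ p a b c q : FA ι, p * (c * (a * b - b * a) - (a * b - b * a) * c) * q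
      = p * c * a * b * q - p * c * b * a * q - p * a * b * c * q + p * b * a * c * q := by
    intros; noncomm_ring
  rw [key]
  simp only [map_add, map_sub]
  induction p using MonoidAlgebra.induction_linear with
  | zero => simp
  | add x y hx hy => simp only [add_mul, mul_add, map_add]; linear_combination hx + hy
  | single wp rp =>
  induction a using MonoidAlgebra.induction_linear with
  | zero => simp
  | add x y hx hy => simp only [add_mul, mul_add, map_add]; linear_combination hx + hy
  | single wa ra =>
  induction b using MonoidAlgebra.induction_linear with
  | zero => simp
  | add x y hx hy => simp only [add_mul, mul_add, map_add]; linear_combination hx + hy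
  | single wb rb =>
  induction c using MonoidAlgebra.induction_linear with
  | zero => simp
  | add x y hx hy => simp only [add_mul, mul_add, map_add]; linear_combination hx + hy
  | single wc rc =>
  induction q using MonoidAlgebra.induction_linear with
  | zero => simp
  | add x y hx hy => simp only [add_mul, mul_add, map_add]; linear_combination hx + hy
  | single wq rq =>
  simp only [MonoidAlgebra.single_mul_single, fn_single]
  linear_combination (rp * ra * rb * rc * rq) * hf wp wa wb wc wq

lemma fn_prod (f : FreeMonoid (Letter ι) → ℝ)
    (hf : ∀ p a b c d q, f (p * c * d * a * b * q) - f (p * c * d * b * a * q)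
      - f (p * d * c * a * b * q) + f (p * d * c * b * a * q) = 0) (p a b c d q : FA ι) :
    fn f (p * ((c * d - d * c) * (a * b - b * a)) * q) = 0 := by
  have key : ∀ p a b c d q : FA ι, p * ((c * d - d * c) * (a * b - b * a)) * q
      = p * c * d * a * b * q - p * c * d * b * a * q
        - p * d * c * a * b * q + p * d * c * b * a * q := by
    intros; noncomm_ring
  rw [key]
  simp only [map_add, map_sub]
  induction p using MonoidAlgebra.induction_linear with
  | zero => simp
  | add x y hx hy => simp only [add_mul, mul_add, map_add]; linear_combination hx + hy
  | single wp rp =>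
  induction a using MonoidAlgebra.induction_linear with
  | zero => simp
  | add x y hx hy => simp only [add_mul, mul_add, map_add]; linear_combination hx + hy
  | single wa ra =>
  induction b using MonoidAlgebra.induction_linear with
  | zero => simp
  | add x y hx hy => simp only [add_mul, mul_add, map_add]; linear_combination hx + hy
  | single wb rb =>
  induction c using MonoidAlgebra.induction_linear with
  | zero => simp
  | add x y hx hy => simp only [add_mul, mul_add, map_add]; linear_combination hx + hy
  | single wc rc =>
  induction d using MonoidAlgebra.induction_linear with
  | zero => simp
  | add x y hx hy => simp only [add_mul, mul_add, map_add]; linear_combination hx + hy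
  | single wd rd =>
  induction q using MonoidAlgebra.induction_linear with
  | zero => simp
  | add x y hx hy => simp only [add_mul, mul_add, map_add]; linear_combination hx + hy
  | single wq rq =>
  simp only [MonoidAlgebra.single_mul_single, fn_single]
  linear_combination (rp * ra * rb * rc * rd * rq) * hf wp wa wb wc wd wq

noncomputable def f0 (L : ι → ℝ) (φ : ℝ → ℝ) (t : ℝ) (w : FreeMonoid (Letter ι)) : ℝ :=
  φ (t + wb L w.toList)
noncomputable def f1 (L l : ι → ℝ) (φ : ℝ → ℝ) (t : ℝ) (w : FreeMonoid (Letter ι)) : ℝ :=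
  deriv φ (t + wb L w.toList) * (wa l w.toList * t + wc L l w.toList)

lemma op_zero (L l : ι → ℝ) (φ : ℝ → ℝ) (t : ℝ) (x : FA ι) :
    op L l 0 x φ t = fn (f0 L φ t) x := by
  induction x using MonoidAlgebra.induction_linear with
  | zero => simp
  | add x y hx hy => simp [hx, hy]
  | single w r =>
    obtain ⟨a, c, h, a0, c0, ha, hc⟩ := word_affine L l w.toList
    rw [op_single, fn_single, f0, h, a0, c0, one_mul]

lemma op_deriv (L l : ι → ℝ) (φ : ℝ → ℝ) (hφ : Differentiable ℝ φ) (t : ℝ) (x : FA ι) :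
    HasDerivAt (fun s => op L l s x φ t) (fn (f1 L l φ t) x) 0 := by
  induction x using MonoidAlgebra.induction_linear with
  | zero => simpa using hasDerivAt_const (0:ℝ) (0:ℝ)
  | add x y hx hy => simpa using hx.fun_add hy
  | single w r =>
    obtain ⟨a, c, h, a0, c0, ha, hc⟩ := word_affine L l w.toList
    simp only [op_single, fn_single, f1, h]
    have h1 : HasDerivAt (fun s => a s * t + c s) (wa l w.toList * t + wc L l w.toList) 0 :=
      (ha.mul_const t).fun_add hc
    have h2 : HasDerivAt φ (deriv φ (t + wb L w.toList)) (a 0 * t + c 0) := by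
      rw [a0, c0, one_mul]; exact (hφ _).hasDerivAt
    exact (HasDerivAt.comp (0:ℝ) h2 h1).const_mul r

end TDI


/-- **Corollary 2.** Let `K` be a finite index set and for each `k ∈ K` let `Δ k` be an
(`s`-dependent) operator of the form `[C, [A, B]]` or `[C, D]∘[A, B]` for polynomials
`A, B, C, D` in the time-delay and time-advance operators, and let `P k`, `Q k` be
further such polynomials. Then the linear combination `Δ = Σ_k P_k ∘ Δ_k ∘ Q_k` vanishes
to first order in the rates: for every smooth `φ` and every `t`, the function
`F(s) = ((Δ)φ)(t)` satisfies `F(0) = 0` and `F′(0) = 0`. -/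
theorem corollary2 (ι : Type*) [Fintype ι] (L l : ι → ℝ)
    (K : Type*) [Fintype K]
    (Δ : K → ℝ → (ℝ → ℝ) → ℝ → ℝ)
    (hΔ : ∀ k : K,
      (∃ A B C : TDI.Poly ι, ∀ s : ℝ,
        Δ k s = TDI.comm (TDI.polyOp L l s C)
          (TDI.comm (TDI.polyOp L l s A) (TDI.polyOp L l s B))) ∨
      (∃ A B C D : TDI.Poly ι, ∀ s : ℝ,
        Δ k s = fun φ => TDI.comm (TDI.polyOp L l s C) (TDI.polyOp L l s D)
          (TDI.comm (TDI.polyOp L l s A) (TDI.polyOp L l s B) φ)))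
    (P Q : K → TDI.Poly ι) (φ : ℝ → ℝ) (hφ : ContDiff ℝ (⊤ : ℕ∞) φ) (t : ℝ) :
    (∑ k : K, TDI.polyOp L l 0 (P k) (Δ k 0 (TDI.polyOp L l 0 (Q k) φ)) t) = 0 ∧
      HasDerivAt
        (fun s : ℝ =>
          ∑ k : K, TDI.polyOp L l s (P k) (Δ k s (TDI.polyOp L l s (Q k) φ)) t)
        0 0 := by
  have key : ∀ k, ∃ x : TDI.FA ι,
      (∀ s, TDI.polyOp L l s (P k) (Δ k s (TDI.polyOp L l s (Q k) φ)) t = TDI.op L l s x φ t) ∧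
      TDI.fn (TDI.f0 L φ t) x = 0 ∧ TDI.fn (TDI.f1 L l φ t) x = 0 := by
    intro k
    rcases hΔ k with ⟨A, B, C, h⟩ | ⟨A, B, C, D, h⟩
    · refine ⟨TDI.toFA (P k) * (TDI.toFA C * (TDI.toFA A * TDI.toFA B - TDI.toFA B * TDI.toFA A)
        - (TDI.toFA A * TDI.toFA B - TDI.toFA B * TDI.toFA A) * TDI.toFA C) * TDI.toFA (Q k),
        ?_, ?_, ?_⟩
      · intro s
        rw [h]
        simp only [TDI.polyOp_eq, TDI.comm_eq, ← map_mul, ← map_sub]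
        simp only [map_mul (TDI.op L l s), Module.End.mul_apply]
      · apply TDI.fn_dbl
        intro p a b c q
        simp only [TDI.f0, FreeMonoid.toList_mul, TDI.wb_append]
        ring_nf
      · apply TDI.fn_dbl
        intro p a b c q
        simp only [TDI.f1, FreeMonoid.toList_mul, TDI.wb_append, TDI.wa_append, TDI.wc_append]
        ring_nf
    · refine ⟨TDI.toFA (P k) * ((TDI.toFA C * TDI.toFA D - TDI.toFA D * TDI.toFA C) *
        (TDI.toFA A * TDI.toFA B - TDI.toFA B * TDI.toFA A)) * TDI.toFA (Q k),
        ?_, ?_, ?_⟩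
      · intro s
        rw [h]
        simp only [TDI.polyOp_eq, TDI.comm_eq, ← map_mul, ← map_sub]
        simp only [map_mul (TDI.op L l s), Module.End.mul_apply]
      · apply TDI.fn_prod
        intro p a b c d q
        simp only [TDI.f0, FreeMonoid.toList_mul, TDI.wb_append]
        ring_nf
      · apply TDI.fn_prod
        intro p a b c d q
        simp only [TDI.f1, FreeMonoid.toList_mul, TDI.wb_append, TDI.wa_append, TDI.wc_append]
        ring_nf
  choose x hx h0 h1 using key
  have hd : Differentiable ℝ φ := hφ.differentiable (by simp)
  simp only [hx]
  refine ⟨Finset.sum_eq_zero fun k _ => by rw [TDI.op_zero, h0], ?_⟩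
  have := HasDerivAt.fun_sum (u := Finset.univ) fun k _ => TDI.op_deriv L l φ hd t (x k)
  simpa [h1] using this
end
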